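/- arXiv:2002.02398 — 2 statements merged into one kernel-verified Lean document; each statement's English description precedes it below -/
import Mathlib

section
/- Let x₀ be an irrational real number that is algebraic of degree m ≥ 2 over ℚ. Then there exists a constant c > 0 such that |sin(nπx₀)| ≥ c/n^{m-1} for every integer n ≥ 1. -/
open Real

/-- The chord bound `2 · dist(y, ℤ) ≤ |sin(πy)|`. -/
lemma two_mul_abs_sub_round_le_abs_sin (y : ℝ) :
    2 * |y - round y| ≤ |Real.sin (π * y)| := by
  have hsin : |Real.sin (π * y)| = |Real.sin (π * (y - round y))| := by
    rw [mul_sub, mul_comm π (round y : ℝ), Real.sin_sub_int_mul_pi]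
    simp [abs_mul]
  have habs : |π * (y - round y)| = π * |y - round y| := by
    rw [abs_mul, abs_of_pos pi_pos]
  have h := Real.mul_abs_le_abs_sin (x := π * (y - round y)) (by
    rw [habs]
    nlinarith [abs_sub_round y, pi_pos])
  rw [habs] at h
  rw [hsin]
  calc 2 * |y - round y| = 2 / π * (π * |y - round y|) := by field_simp
    _ ≤ _ := h

/-- An algebraic number is a root of a nonzero integer polynomial of the degree of its
minimal polynomial over `ℚ`. -/
lemma exists_int_polynomial_natDegree_eq_minpoly {x : ℝ} (hx : IsAlgebraic ℚ x) :
    ∃ f : Polynomial ℤ, f ≠ 0 ∧ f.natDegree = (minpoly ℚ x).natDegree ∧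
      Polynomial.eval x (f.map (algebraMap ℤ ℝ)) = 0 := by
  refine ⟨IsLocalization.integerNormalization (nonZeroDivisors ℤ) (minpoly ℚ x), ?_, ?_, ?_⟩
  · exact fun h => minpoly.ne_zero hx.isIntegral
      (IsFractionRing.integerNormalization_eq_zero_iff.mp h)
  · obtain ⟨b, hb, hf⟩ := IsLocalization.integerNormalization_spec
      (nonZeroDivisors ℤ) (minpoly ℚ x)
    rw [← Polynomial.natDegree_map_eq_of_injective (algebraMap ℤ ℚ).injective_int, hf]
    exact Polynomial.natDegree_smul _ (nonZeroDivisors.ne_zero hb)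
  · rw [Polynomial.eval_map_algebraMap]
    exact IsLocalization.integerNormalization_aeval_eq_zero _ _ (minpoly.aeval ℚ x)

/-- If `x₀` is an irrational algebraic number of degree `m ≥ 2` over `ℚ`, then there is
`c > 0` with `|sin(nπx₀)| ≥ c/n^{m-1}` for every integer `n ≥ 1` (Liouville's theorem). -/
theorem sin_lower_bound_of_algebraic (x₀ : ℝ) (m : ℕ) (hm : 2 ≤ m)
    (hirr : Irrational x₀) (halg : IsAlgebraic ℚ x₀)
    (hdeg : (minpoly ℚ x₀).natDegree = m) :
    ∃ c > (0 : ℝ), ∀ n : ℕ+, c / (n : ℝ) ^ (m - 1) ≤ |Real.sin ((n : ℝ) * π * x₀)| := by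
  obtain ⟨f, hf0, hfdeg, hfx⟩ := exists_int_polynomial_natDegree_eq_minpoly halg
  obtain ⟨A, hA, hL⟩ := Liouville.exists_pos_real_of_irrational_root hirr hf0 hfx
  refine ⟨2 / A, by positivity, fun n => ?_⟩
  have hn : (0 : ℝ) < n := by exact_mod_cast n.pos
  have hpred : (((n : ℕ) - 1 : ℕ) : ℝ) + 1 = n := by
    exact_mod_cast Nat.sub_add_cancel n.pos
  have h := hL (round ((n : ℝ) * x₀)) ((n : ℕ) - 1)
  rw [hpred, hfdeg, hdeg] at h
  have hdist : |(n : ℝ) * x₀ - round ((n : ℝ) * x₀)| =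
      n * |x₀ - round ((n : ℝ) * x₀) / n| := by
    rw [← abs_of_pos hn, ← abs_mul, abs_of_pos hn]
    congr 1
    field_simp
  have hpow : (n : ℝ) ^ m = n ^ (m - 1) * n := by
    rw [← pow_succ, Nat.sub_add_cancel (by lia)]
  have hsin := two_mul_abs_sub_round_le_abs_sin ((n : ℝ) * x₀)
  rw [show (n : ℝ) * π * x₀ = π * (n * x₀) by ring]
  refine le_trans ?_ hsin
  rw [hdist, div_div, div_le_iff₀ (by positivity)]
  rw [hpow] at h
  linarith
end

section
/- Let x₀ ∈ ℝ, let n ≥ 1 be an integer, and let ε > 0 satisfy ε ≤ θₙ, where θₙ = inf { |x₀ - p/n| : p ∈ ℤ }. Then | ∫_{x₀-ε}^{x₀+ε} sin(nπx) dx | ≥ (4/π) ε |sin(nπx₀)|. -/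
open Real

/-- The distance from `x` to the lattice `(1/n)ℤ` of rationals with denominator `n`. -/
noncomputable def latticeDist (x : ℝ) (n : ℕ+) : ℝ :=
  sInf {d : ℝ | ∃ p : ℤ, d = |x - (p : ℝ) / (n : ℝ)|}

theorem latticeDist_le_half_div (x : ℝ) (n : ℕ+) : latticeDist x n ≤ 1 / 2 / (n : ℝ) := by
  have hn : (0 : ℝ) < n := by exact_mod_cast n.pos
  have hbdd : BddBelow {d : ℝ | ∃ p : ℤ, d = |x - (p : ℝ) / (n : ℝ)|} :=
    ⟨0, by rintro _ ⟨p, rfl⟩; exact abs_nonneg _⟩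
  refine (csInf_le hbdd ⟨round ((n : ℝ) * x), rfl⟩).trans ?_
  rw [le_div_iff₀ hn]
  calc |x - (round ((n : ℝ) * x) : ℝ) / n| * n
      = |(n : ℝ) * x - round ((n : ℝ) * x)| := by
        rw [← abs_of_pos hn, ← abs_mul, abs_of_pos hn]
        congr 1
        field_simp
    _ ≤ 1 / 2 := abs_sub_round _

theorem integral_sin_mul_symm (c x₀ ε : ℝ) (hc : c ≠ 0) :
    ∫ x in (x₀ - ε)..(x₀ + ε), Real.sin (c * x) =
      2 / c * Real.sin (c * ε) * Real.sin (c * x₀) := by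
  rw [intervalIntegral.integral_comp_mul_left (fun x => Real.sin x) hc, integral_sin,
    mul_sub, mul_add, Real.cos_sub, Real.cos_add, smul_eq_mul]
  field_simp
  ring

/-- If `0 < ε ≤ θₙ = dist(x₀, (1/n)ℤ)` (so that `sin(nπx)` has constant sign on
`(x₀-ε, x₀+ε)`), then `|∫_{x₀-ε}^{x₀+ε} sin(nπx) dx| ≥ (4/π) ε |sin(nπx₀)|`. -/
theorem integral_sin_lower_bound_small_eps (x₀ : ℝ) (n : ℕ+) (ε : ℝ) (hε : 0 < ε)
    (hεθ : ε ≤ latticeDist x₀ n) :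
    4 / π * ε * |Real.sin ((n : ℝ) * π * x₀)| ≤
      |∫ x in (x₀ - ε)..(x₀ + ε), Real.sin ((n : ℝ) * π * x)| := by
  have hn : (0 : ℝ) < n := by exact_mod_cast n.pos
  have hc : 0 < (n : ℝ) * π := mul_pos hn pi_pos
  have hnε : ε * n ≤ 1 / 2 :=
    (le_div_iff₀ hn).1 (hεθ.trans (latticeDist_le_half_div x₀ n))
  have hsin : 2 / π * ((n : ℝ) * π * ε) ≤ Real.sin ((n : ℝ) * π * ε) :=
    Real.mul_le_sin (by positivity) (by nlinarith [pi_pos])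
  rw [integral_sin_mul_symm _ _ _ hc.ne', abs_mul]
  refine mul_le_mul_of_nonneg_right (le_trans ?_ (le_abs_self _)) (abs_nonneg _)
  calc 4 / π * ε = 2 / ((n : ℝ) * π) * (2 / π * ((n : ℝ) * π * ε)) := by
        field_simp
        norm_num
    _ ≤ 2 / ((n : ℝ) * π) * Real.sin ((n : ℝ) * π * ε) := by gcongr
end
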